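/- arXiv:1410.3022 — 7 statements merged into one kernel-verified Lean document; each statement's English description precedes it below -/
import Mathlib

section
/- A 0–1 matrix M (with at least one column) has the circular ones property if and only if the matrix M' obtained from M by complementing (inverting) every row that has a 1 in the first column and then deleting the first column has the consecutive ones property. -/
/-- A 0-1 row, read along positions `Fin m`, *alternates* if there are four
increasing positions carrying the pattern `1,0,1,0` or `0,1,0,1`.  A row is
free of alternations iff either its ones or its zeros occupy a set of
cyclically consecutive positions. -/
def BoolAlternates {m : ℕ} (f : Fin m → Bool) : Prop :=
  ∃ k₁ k₂ k₃ k₄ : Fin m, k₁ < k₂ ∧ k₂ < k₃ ∧ k₃ < k₄ ∧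
    ((f k₁ = true ∧ f k₂ = false ∧ f k₃ = true ∧ f k₄ = false) ∨
     (f k₁ = false ∧ f k₂ = true ∧ f k₃ = false ∧ f k₄ = true))

/-- A 0-1 matrix has the *circular ones property* if its columns can be permuted
so that in every row either the ones or the zeros occupy a set of consecutive
positions in the circular order, i.e. every row is alternation-free. -/
def HasCircularOnes {n m : ℕ} (M : Fin n → Fin m → Bool) : Prop :=
  ∃ σ : Equiv.Perm (Fin m), ∀ i : Fin n, ¬ BoolAlternates (fun k => M i (σ k))

/-- A 0-1 matrix has the *consecutive ones property* if its columns can be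
permuted so that in every row the ones occupy a set of consecutive positions,
i.e. no row contains the pattern `1,0,1` at increasing positions. -/
def HasConsecutiveOnes {n m : ℕ} (M : Fin n → Fin m → Bool) : Prop :=
  ∃ σ : Equiv.Perm (Fin m), ∀ i : Fin n,
    ¬ ∃ k₁ k₂ k₃ : Fin m, k₁ < k₂ ∧ k₂ < k₃ ∧
      M i (σ k₁) = true ∧ M i (σ k₂) = false ∧ M i (σ k₃) = true

theorem BoolAlternates.of_add_right {m : ℕ} {f : Fin (m + 1) → Bool} (p : Fin (m + 1))
    (h : BoolAlternates (fun k => f (k + p))) : BoolAlternates f := by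
  obtain ⟨k₁, k₂, k₃, k₄, h₁, h₂, h₃, h⟩ := h
  have e (k : Fin (m + 1)) := Fin.val_add_eq_ite k p
  have e₁ := e k₁
  have e₂ := e k₂
  have e₃ := e k₃
  have e₄ := e k₄
  clear e
  simp only [Fin.lt_def] at h₁ h₂ h₃
  dsimp only at h
  generalize k₁ + p = a at *
  generalize k₂ + p = b at *
  generalize k₃ + p = c at *
  generalize k₄ + p = d at *
  have key : (a < b ∧ b < c ∧ c < d) ∨ (d < a ∧ a < b ∧ b < c) ∨
      (c < d ∧ d < a ∧ a < b) ∨ (b < c ∧ c < d ∧ d < a) := by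
    simp only [Fin.lt_def]
    split_ifs at e₁ e₂ e₃ e₄ <;> omega
  rcases key with ⟨x, y, z⟩ | ⟨x, y, z⟩ | ⟨x, y, z⟩ | ⟨x, y, z⟩
  · exact ⟨a, b, c, d, x, y, z, h⟩
  · exact ⟨d, a, b, c, x, y, z, by tauto⟩
  · exact ⟨c, d, a, b, x, y, z, by tauto⟩
  · exact ⟨b, c, d, a, x, y, z, by tauto⟩

/-- A row alternates iff, after complementing it if it starts with `1` and deleting its first
entry, it contains the pattern `1,0,1`. -/
theorem boolAlternates_iff_exists_succ {m : ℕ} (f : Fin (m + 1) → Bool) :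
    BoolAlternates f ↔ ∃ k₁ k₂ k₃ : Fin m, k₁ < k₂ ∧ k₂ < k₃ ∧
      (if f 0 then !(f k₁.succ) else f k₁.succ) = true ∧
      (if f 0 then !(f k₂.succ) else f k₂.succ) = false ∧
      (if f 0 then !(f k₃.succ) else f k₃.succ) = true := by
  constructor
  · rintro ⟨a, b, c, d, hab, hbc, hcd, h⟩
    obtain ⟨b, rfl⟩ := Fin.exists_succ_eq.2 (Fin.ne_zero_of_lt hab)
    obtain ⟨c, rfl⟩ := Fin.exists_succ_eq.2 (Fin.ne_zero_of_lt hbc)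
    obtain ⟨d, rfl⟩ := Fin.exists_succ_eq.2 (Fin.ne_zero_of_lt hcd)
    by_cases ha : f a = f 0
    · refine ⟨b, c, d, Fin.succ_lt_succ_iff.1 hbc, Fin.succ_lt_succ_iff.1 hcd, ?_⟩
      rw [← ha]
      rcases h with ⟨h₁, h₂, h₃, h₄⟩ | ⟨h₁, h₂, h₃, h₄⟩ <;> simp [h₁, h₂, h₃, h₄]
    · obtain ⟨a, rfl⟩ := Fin.exists_succ_eq.2 (show a ≠ 0 from fun h => ha (h ▸ rfl))
      refine ⟨a, b, c, Fin.succ_lt_succ_iff.1 hab, Fin.succ_lt_succ_iff.1 hbc, ?_⟩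
      rcases h with ⟨h₁, h₂, h₃, -⟩ | ⟨h₁, h₂, h₃, -⟩ <;> cases h₀ : f 0 <;> simp_all
  · rintro ⟨a, b, c, hab, hbc, h₁, h₂, h₃⟩
    refine ⟨0, a.succ, b.succ, c.succ, Fin.succ_pos a, Fin.succ_lt_succ_iff.2 hab,
      Fin.succ_lt_succ_iff.2 hbc, ?_⟩
    cases h₀ : f 0 <;> simp_all

/-- A 0-1 matrix `M` with at least one column has the circular
ones property iff the matrix `M'`, obtained from `M` by complementing every row
having a `1` in the first column and then deleting the first column, has the
consecutive ones property. -/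
theorem hasCircularOnes_iff_hasConsecutiveOnes {n m : ℕ} (M : Fin n → Fin (m + 1) → Bool) :
    HasCircularOnes M ↔
      HasConsecutiveOnes (fun (i : Fin n) (j : Fin m) =>
        if M i 0 then !(M i j.succ) else M i j.succ) := by
  constructor
  · rintro ⟨σ, hσ⟩
    obtain ⟨⟨q, e⟩, he⟩ := Equiv.Perm.decomposeFin.symm.surjective
      ((Equiv.addRight (σ.symm 0)).trans σ)
    have hq : q = 0 := by
      rw [← Equiv.Perm.decomposeFin_symm_apply_zero q e, he]
      simp
    subst hq
    have hs (k : Fin m) : σ (k.succ + σ.symm 0) = (e k).succ := by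
      simpa using (congrArg (fun τ : Equiv.Perm (Fin (m + 1)) => τ k.succ) he).symm
    refine ⟨e, fun i h => hσ i (.of_add_right (σ.symm 0) ?_)⟩
    rw [boolAlternates_iff_exists_succ]
    simpa only [zero_add, Equiv.apply_symm_apply, hs] using h
  · rintro ⟨e, he⟩
    refine ⟨Equiv.Perm.decomposeFin.symm (0, e), fun i h => he i ?_⟩
    rw [boolAlternates_iff_exists_succ] at h
    simpa only [Equiv.Perm.decomposeFin_symm_apply_zero, Equiv.Perm.decomposeFin_symm_apply_succ,
      Equiv.swap_self, Equiv.refl_apply] using h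
end

section
/- Let C = v₁v₂…v_{2a}, with a ≥ 2, be an even cycle whose vertices are indexed 1, …, 2a in cyclic order, and let V' be a subset of its vertices of size at least a + 2. Then V' contains four vertices v_i, v_j, v_k, v_l with i < j < k < l such that i and k are odd and j and l are even, or i and k are even and j and l are odd. -/
theorem two_mul_card_le_of_same_parity {S : Finset ℕ} {m n : ℕ} (hS : S ⊆ Finset.Icc m n)
    (hmn : m ≤ n) (hpar : ∀ x ∈ S, x % 2 = m % 2) : 2 * S.card ≤ n - m + 2 := by
  have h : S.card ≤ (Finset.range ((n - m) / 2 + 1)).card := by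
    refine Finset.card_le_card_of_injOn (fun x => (x - m) / 2) (fun x hx => ?_)
      (fun x hx y hy hxy => ?_)
    · have := Finset.mem_Icc.1 (hS hx)
      simp only [Finset.coe_range, Set.mem_Iio]
      omega
    · have hx' := Finset.mem_Icc.1 (hS hx)
      have hy' := Finset.mem_Icc.1 (hS hy)
      have hpx := hpar x hx
      have hpy := hpar y hy
      simp only at hxy
      omega
  rw [Finset.card_range] at h
  omega

/-- Passing from `m` to the first later element of the other parity lowers the excess of
`2 * S.card` over the length of the ambient interval by at most one. -/
theorem exists_next_of_opposite_parity {S : Finset ℕ} {m n r : ℕ} (hS : S ⊆ Finset.Icc m n)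
    (hm : m ∈ S) (hr : 1 ≤ r) (hcard : n + 1 + (r + 1) ≤ 2 * S.card + m) :
    ∃ t ∈ S, m < t ∧ t % 2 ≠ m % 2 ∧
      ∃ S' ⊆ S, S' ⊆ Finset.Icc t n ∧ t ∈ S' ∧ n + 1 + r ≤ 2 * S'.card + t := by
  classical
  have hmn := (Finset.mem_Icc.1 (hS hm)).2
  have hex : ∃ t, t ∈ S ∧ t % 2 ≠ m % 2 := by
    by_contra! h
    have := two_mul_card_le_of_same_parity hS hmn h
    omega
  obtain ⟨htS, htpar⟩ := Nat.find_spec hex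
  have hmin : ∀ x ∈ S, x < Nat.find hex → x % 2 = m % 2 := fun x hx hlt => by
    by_contra hne
    exact Nat.find_min hex hlt ⟨hx, hne⟩
  generalize Nat.find hex = t at htS htpar hmin
  have hmt : m < t := by
    have := (Finset.mem_Icc.1 (hS htS)).1
    have : t ≠ m := fun h => htpar (by rw [h])
    omega
  refine ⟨t, htS, hmt, htpar, S.filter (t ≤ ·), Finset.filter_subset _ _, fun x hx => ?_,
    by simp [htS], ?_⟩
  · have hx := Finset.mem_filter.1 hx
    exact Finset.mem_Icc.2 ⟨hx.2, (Finset.mem_Icc.1 (hS hx.1)).2⟩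
  · have hlow : S.filter (¬ t ≤ ·) ⊆ Finset.Icc m (t - 1) := fun x hx => by
      have hx := Finset.mem_filter.1 hx
      have := Finset.mem_Icc.1 (hS hx.1)
      rw [Finset.mem_Icc]
      omega
    have hlowcard := two_mul_card_le_of_same_parity hlow (by omega) fun x hx => by
      have hx := Finset.mem_filter.1 hx
      exact hmin x hx.1 (by omega)
    have hsplit := Finset.card_filter_add_card_filter_not (s := S) (t ≤ ·)
    omega

/-- Let `C = v₁v₂…v_{2a}` (`a ≥ 2`) be an even cycle whose
vertices are identified with their indices `1, …, 2a`, and let `V'` be a subset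
of its vertices of size at least `a + 2`.  Then `V'` contains four vertices
`v_i, v_j, v_k, v_l` with `i < j < k < l` such that `i, k` are odd and `j, l`
are even, or `i, k` are even and `j, l` are odd. -/
theorem even_cycle_alternating_four (a : ℕ) (ha : 2 ≤ a) (V' : Finset ℕ)
    (hsub : V' ⊆ Finset.Icc 1 (2 * a)) (hcard : a + 2 ≤ V'.card) :
    ∃ i ∈ V', ∃ j ∈ V', ∃ k ∈ V', ∃ l ∈ V',
      i < j ∧ j < k ∧ k < l ∧
      ((Odd i ∧ Even j ∧ Odd k ∧ Even l) ∨ (Even i ∧ Odd j ∧ Even k ∧ Odd l)) := by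
  have hne : V'.Nonempty := Finset.card_pos.1 (by omega)
  have hi := V'.min'_mem hne
  have hle : ∀ x ∈ V', V'.min' hne ≤ x := fun x hx => V'.min'_le x hx
  generalize V'.min' hne = i at hi hle
  have hi1 := (Finset.mem_Icc.1 (hsub hi)).1
  have hV : V' ⊆ Finset.Icc i (2 * a) := fun x hx =>
    Finset.mem_Icc.2 ⟨hle x hx, (Finset.mem_Icc.1 (hsub hx)).2⟩
  obtain ⟨j, hj, hij, hpj, S, hSV, hS, hjS, hcS⟩ :=
    exists_next_of_opposite_parity (r := 3) hV hi (by omega) (by omega)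
  obtain ⟨k, hk, hjk, hpk, T, hTS, hT, hkT, hcT⟩ :=
    exists_next_of_opposite_parity (r := 2) hS hjS (by omega) hcS
  obtain ⟨l, hl, hkl, hpl, -⟩ :=
    exists_next_of_opposite_parity (r := 1) hT hkT (by omega) hcT
  refine ⟨i, hi, j, hj, k, hSV hk, l, hSV (hTS hl), hij, hjk, hkl, ?_⟩
  simp only [Nat.odd_iff, Nat.even_iff]
  omega
end

section
/- Let a, b, c, d, e be five pairwise distinct elements of a set equipped with a circular (cyclic) order. For pairwise distinct elements x, y, z, w write {xy}{zw} if x and y are consecutive when the circular order is restricted to {x, y, z, w}, i.e., if the pair {z, w} does not separate the pair {x, y}. If {ab}{cd} is false and {ab}{de} is true, then {ab}{ce} is false. -/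
/-- In a circular order, the pair `{z, w}` *separates* the pair `{x, y}` if `z`
and `w` lie in different open arcs determined by `x` and `y`. -/
def Separates {α : Type*} [CircularOrder α] (x y z w : α) : Prop :=
  (sbtw x z y ∧ sbtw y w x) ∨ (sbtw x w y ∧ sbtw y z x)

/-- `{xy}{zw}`: among the four pairwise distinct elements `x, y, z, w`, the
elements `x` and `y` are consecutive when the circular order is restricted to
`{x, y, z, w}`, i.e. the pair `{z, w}` does not separate the pair `{x, y}`. -/
def Together {α : Type*} [CircularOrder α] (x y z w : α) : Prop :=
  ¬ Separates x y z w

/-- Three pairwise distinct elements of a circular order are strictly ordered in one of the two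
directions. -/
theorem sbtw_or_sbtw_of_ne {α : Type*} [CircularOrder α] {x y z : α}
    (hxy : x ≠ y) (hyz : y ≠ z) (hzx : z ≠ x) : sbtw x y z ∨ sbtw z y x := by
  by_contra! h
  rw [← btw_iff_not_sbtw, ← btw_iff_not_sbtw] at h
  rcases h.1.antisymm h.2 with h | h | h
  exacts [hyz h.symm, hxy h.symm, hzx h.symm]

/-- For five pairwise distinct elements `a, b, c, d, e` of a
circularly ordered set: if `{ab}{cd}` is false and `{ab}{de}` is true, then
`{ab}{ce}` is false. -/
theorem not_together_of_together {α : Type*} [CircularOrder α] (a b c d e : α)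
    (hab : a ≠ b) (hac : a ≠ c) (had : a ≠ d) (hae : a ≠ e)
    (hbc : b ≠ c) (hbd : b ≠ d) (hbe : b ≠ e)
    (hcd : c ≠ d) (hce : c ≠ e) (hde : d ≠ e)
    (h₁ : ¬ Together a b c d) (h₂ : Together a b d e) :
    ¬ Together a b c e := by
  unfold Together at *
  rw [not_not] at h₁ ⊢
  have he := sbtw_or_sbtw_of_ne hae hbe.symm hab.symm
  rcases h₁ with ⟨hc, hd⟩ | ⟨hd, hc⟩
  · exact Or.inl ⟨hc, he.resolve_left fun he' => h₂ (Or.inr ⟨he', hd⟩)⟩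
  · exact Or.inr ⟨he.resolve_right fun he' => h₂ (Or.inl ⟨hd, he'⟩), hc⟩
end

section
/- Let G be a simple graph with an integer vertex labeling γ whose values differ by at most 1 on adjacent vertices. If an s-cap P contains a vertex v, then for every integer s' with s < s' < γ(v) the path P contains, as a contiguous subpath, an s'-cap that contains v. Dually, if a b-cup P contains a vertex v, then for every integer b' with γ(v) < b' < b the path P contains, as a contiguous subpath, a b'-cup that contains v. -/
/-- `P` is an *s-cap*: `P` is a path, both end vertices have label `s`,
`s` is the minimum label on `P`, and no internal vertex of `P` has label `s`. -/
def IsCap {V : Type*} {G : SimpleGraph V} (γ : V → ℤ) (s : ℤ) {u v : V}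
    (P : G.Walk u v) : Prop :=
  P.IsPath ∧ γ u = s ∧ γ v = s ∧ (∀ w ∈ P.support, s ≤ γ w) ∧
    ∀ w ∈ P.support, w ≠ u → w ≠ v → γ w ≠ s

/-- `P` is a *b-cup*: `P` is a path, both end vertices have label `b`,
`b` is the maximum label on `P`, and no internal vertex of `P` has label `b`. -/
def IsCup {V : Type*} {G : SimpleGraph V} (γ : V → ℤ) (b : ℤ) {u v : V}
    (P : G.Walk u v) : Prop :=
  P.IsPath ∧ γ u = b ∧ γ v = b ∧ (∀ w ∈ P.support, γ w ≤ b) ∧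
    ∀ w ∈ P.support, w ≠ u → w ≠ v → γ w ≠ b

/-- A walk along which an integer labeling changes by at most `1` per step, and which goes from a
label at least `c` to a label at most `c`, splits at its first vertex labeled `c`. -/
theorem SimpleGraph.Walk.exists_append_first_label {V : Type*} {G : SimpleGraph V} {γ : V → ℤ}
    (hγ : ∀ u v : V, G.Adj u v → |γ u - γ v| ≤ 1) {c : ℤ} {x v : V} (p : G.Walk x v)
    (hx : c ≤ γ x) (hv : γ v ≤ c) :
    ∃ (v' : V) (q : G.Walk x v') (r : G.Walk v' v),
      p = q.append r ∧ γ v' = c ∧ ∀ w ∈ q.support, w ≠ v' → c < γ w := by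
  induction p with
  | nil => exact ⟨_, .nil, .nil, rfl, le_antisymm hv hx, by simp⟩
  | @cons a b d h p ih =>
    rcases hx.eq_or_lt with hc | hc
    · exact ⟨a, .nil, .cons h p, rfl, hc.symm, by simp⟩
    · have hb := abs_le.mp (hγ _ _ h)
      obtain ⟨v', q, r, rfl, hv', hq⟩ := ih (by omega) hv
      refine ⟨v', .cons h q, r, rfl, hv', fun w hw hne => ?_⟩
      rcases List.mem_cons.mp hw with rfl | hw
      · exact hc
      · exact hq w hw hne

theorem IsCap.exists_subpath {V : Type*} {G : SimpleGraph V} {γ : V → ℤ}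
    (hγ : ∀ u v : V, G.Adj u v → |γ u - γ v| ≤ 1) {s s' : ℤ} {u v x : V} {P : G.Walk u v}
    (hP : IsCap γ s P) (hx : x ∈ P.support) (hs : s < s') (hs' : s' < γ x) :
    ∃ (u' v' : V) (W₁ : G.Walk u u') (Q : G.Walk u' v') (W₂ : G.Walk v' v),
      P = (W₁.append Q).append W₂ ∧ IsCap γ s' Q ∧ x ∈ Q.support := by
  obtain ⟨hpath, hu, hv, -, -⟩ := hP
  obtain ⟨A, B, rfl⟩ := SimpleGraph.Walk.mem_support_iff_exists_append.mp hx
  obtain ⟨u', A₂, A₁, hA, hu', hA₂⟩ :=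
    A.reverse.exists_append_first_label hγ hs'.le (by omega)
  obtain ⟨v', B₁, B₂, rfl, hv', hB₁⟩ := B.exists_append_first_label hγ hs'.le (by omega)
  obtain rfl : A = A₁.reverse.append A₂.reverse := by
    rw [← SimpleGraph.Walk.reverse_append, ← hA, SimpleGraph.Walk.reverse_reverse]
  have heq : (A₁.reverse.append A₂.reverse).append (B₁.append B₂) =
      (A₁.reverse.append (A₂.reverse.append B₁)).append B₂ := by
    simp only [SimpleGraph.Walk.append_assoc]
  rw [heq] at hpath
  have hQ : ∀ w ∈ (A₂.reverse.append B₁).support, w ≠ u' → w ≠ v' → s' < γ w := by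
    intro w hw hwu hwv
    rw [SimpleGraph.Walk.mem_support_append_iff, SimpleGraph.Walk.support_reverse,
      List.mem_reverse] at hw
    exact hw.elim (fun h => hA₂ w h hwu) fun h => hB₁ w h hwv
  refine ⟨u', v', A₁.reverse, A₂.reverse.append B₁, B₂, heq,
    ⟨hpath.of_append_left.of_append_right, hu', hv', fun w hw => ?_,
      fun w hw hwu hwv => (hQ w hw hwu hwv).ne'⟩, by simp⟩
  by_cases hwu : w = u'
  · exact (hwu ▸ hu').ge
  by_cases hwv : w = v'
  · exact (hwv ▸ hv').ge
  · exact (hQ w hw hwu hwv).le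

theorem isCap_neg_iff_isCup {V : Type*} {G : SimpleGraph V} {γ : V → ℤ} {b : ℤ} {u v : V}
    {P : G.Walk u v} : IsCap (fun w => -γ w) (-b) P ↔ IsCup γ b P := by
  simp only [IsCap, IsCup, neg_inj, neg_le_neg_iff, ne_eq]

/-- Let `G` be a simple graph with an integer vertex labeling
`γ` whose values differ by at most `1` on adjacent vertices.  If an `s`-cap `P`
contains a vertex `x`, then for every integer `s'` with `s < s' < γ x` the path
`P` contains, as a contiguous subpath, an `s'`-cap containing `x`.  Dually, if
a `b`-cup `P` contains a vertex `x`, then for every integer `b'` with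
`γ x < b' < b` the path `P` contains, as a contiguous subpath, a `b'`-cup
containing `x`. -/
theorem cap_cup_contiguous_subpaths {V : Type*} (G : SimpleGraph V) (γ : V → ℤ)
    (hγ : ∀ u v : V, G.Adj u v → |γ u - γ v| ≤ 1) :
    (∀ (s s' : ℤ) (u v x : V) (P : G.Walk u v),
        IsCap γ s P → x ∈ P.support → s < s' → s' < γ x →
        ∃ (u' v' : V) (W₁ : G.Walk u u') (Q : G.Walk u' v') (W₂ : G.Walk v' v),
          P = (W₁.append Q).append W₂ ∧ IsCap γ s' Q ∧ x ∈ Q.support) ∧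
    (∀ (b b' : ℤ) (u v x : V) (P : G.Walk u v),
        IsCup γ b P → x ∈ P.support → γ x < b' → b' < b →
        ∃ (u' v' : V) (W₁ : G.Walk u u') (Q : G.Walk u' v') (W₂ : G.Walk v' v),
          P = (W₁.append Q).append W₂ ∧ IsCup γ b' Q ∧ x ∈ Q.support) := by
  refine ⟨fun s s' u v x P hP hx hs hs' => hP.exists_subpath hγ hx hs hs',
    fun b b' u v x P hP hx hb' hb => ?_⟩
  have hγ' : ∀ u v : V, G.Adj u v → |-γ u - -γ v| ≤ 1 := fun u v h => by
    rw [neg_sub_neg]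
    exact hγ v u h.symm
  simpa only [isCap_neg_iff_isCup] using
    (isCap_neg_iff_isCup.mpr hP).exists_subpath hγ' hx (neg_lt_neg hb) (neg_lt_neg hb')
end

section
/- Let G be a subdivided star with center v, equipped with an integer vertex labeling γ whose values differ by at most 1 on adjacent vertices, and let I be the set of all pairs (s, b) of integers such that there exists an interleaving pair consisting of an s-cap P₁ and a b-cup P₂ in G, each of which contains v as an internal vertex. If s < s' < b < b' and the set I contains both (s, b) and (s', b'), then I also contains (s, b') and (s', b). -/
/-- The minimum label of a vertex of the walk `P`. -/
def minLab {V : Type*} {G : SimpleGraph V} (γ : V → ℤ) {u v : V} (P : G.Walk u v) : ℤ :=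
  (P.support.map γ).foldr min (γ u)

/-- The maximum label of a vertex of the walk `P`. -/
def maxLab {V : Type*} {G : SimpleGraph V} (γ : V → ℤ) {u v : V} (P : G.Walk u v) : ℤ :=
  (P.support.map γ).foldr max (γ u)

/-- `P₁` and `P₂` intersect in a path (possibly a single vertex): the common
vertices of `P₁` and `P₂` are exactly the vertices of some path of `G`. -/
def IntersectInPath {V : Type*} {G : SimpleGraph V} {u₁ v₁ u₂ v₂ : V}
    (P₁ : G.Walk u₁ v₁) (P₂ : G.Walk u₂ v₂) : Prop :=
  ∃ (a c : V) (R : G.Walk a c), R.IsPath ∧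
    ∀ w : V, w ∈ R.support ↔ (w ∈ P₁.support ∧ w ∈ P₂.support)

/-- An *interleaving pair* consisting of an `s`-cap `P₁` and a `b`-cup `P₂`:
`min(P₁) < min(P₂) ≤ max(P₁) < max(P₂)` and `P₁`, `P₂` intersect in a path. -/
def InterleavingPair {V : Type*} {G : SimpleGraph V} (γ : V → ℤ) (s b : ℤ)
    {u₁ v₁ u₂ v₂ : V} (P₁ : G.Walk u₁ v₁) (P₂ : G.Walk u₂ v₂) : Prop :=
  IsCap γ s P₁ ∧ IsCup γ b P₂ ∧
    minLab γ P₁ < minLab γ P₂ ∧ minLab γ P₂ ≤ maxLab γ P₁ ∧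
    maxLab γ P₁ < maxLab γ P₂ ∧ IntersectInPath P₁ P₂

/-- `(s, b) ∈ I`: there is an interleaving pair consisting of an `s`-cap and a
`b`-cup, each of which contains `v₀` as an internal vertex. -/
def RealizesPair {V : Type*} (G : SimpleGraph V) (γ : V → ℤ) (v₀ : V) (s b : ℤ) : Prop :=
  ∃ (u₁ w₁ u₂ w₂ : V) (P₁ : G.Walk u₁ w₁) (P₂ : G.Walk u₂ w₂),
    InterleavingPair γ s b P₁ P₂ ∧
    v₀ ∈ P₁.support ∧ v₀ ≠ u₁ ∧ v₀ ≠ w₁ ∧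
    v₀ ∈ P₂.support ∧ v₀ ≠ u₂ ∧ v₀ ≠ w₂

namespace SimpleGraph.Walk

variable {V : Type*} {G : SimpleGraph V}

theorem lt_minLab_iff (γ : V → ℤ) {u v : V} (P : G.Walk u v) (k : ℤ) :
    k < minLab γ P ↔ ∀ w ∈ P.support, k < γ w := by
  have key : ∀ (l : List V) (a : ℤ),
      k < (l.map γ).foldr min a ↔ k < a ∧ ∀ w ∈ l, k < γ w := by
    intro l a
    induction l with
    | nil => simp
    | cons x l ih => simp [ih]; tauto
  rw [minLab, key]
  exact ⟨fun h => h.2, fun h => ⟨h u P.start_mem_support, h⟩⟩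

theorem maxLab_lt_iff (γ : V → ℤ) {u v : V} (P : G.Walk u v) (k : ℤ) :
    maxLab γ P < k ↔ ∀ w ∈ P.support, γ w < k := by
  have key : ∀ (l : List V) (a : ℤ),
      (l.map γ).foldr max a < k ↔ a < k ∧ ∀ w ∈ l, γ w < k := by
    intro l a
    induction l with
    | nil => simp
    | cons x l ih => simp [ih]; tauto
  rw [maxLab, key]
  exact ⟨fun h => h.2, fun h => ⟨h u P.start_mem_support, h⟩⟩

theorem minLab_le (γ : V → ℤ) {u v w : V} (P : G.Walk u v) (hw : w ∈ P.support) :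
    minLab γ P ≤ γ w :=
  not_lt.1 fun h => lt_irrefl _ ((lt_minLab_iff γ P _).1 h w hw)

theorem le_maxLab (γ : V → ℤ) {u v w : V} (P : G.Walk u v) (hw : w ∈ P.support) :
    γ w ≤ maxLab γ P :=
  not_lt.1 fun h => lt_irrefl _ ((maxLab_lt_iff γ P _).1 h w hw)

/-- A path with a vertex in `S` has an initial segment that ends in `S` and contains all its
vertices in `S`. -/
theorem IsPath.exists_prefix_last_mem {S : Set V} {u v : V} {P : G.Walk u v} (hP : P.IsPath)
    (hS : ∃ w ∈ P.support, w ∈ S) :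
    ∃ (c : V) (R : G.Walk u c), R.IsPath ∧ c ∈ S ∧ R.support ⊆ P.support ∧
      ∀ w ∈ P.support, w ∈ S → w ∈ R.support := by
  induction P with
  | nil =>
    obtain ⟨w, hw, hwS⟩ := hS
    rw [support_nil, List.mem_singleton] at hw
    exact ⟨_, .nil, .nil, hw ▸ hwS, List.Subset.refl _, fun _ h _ => h⟩
  | @cons u x v h P ih =>
    rw [cons_isPath_iff] at hP
    by_cases hex : ∃ w ∈ P.support, w ∈ S
    · obtain ⟨c, R, hR, hc, hsub, hall⟩ := ih hP.1 hex
      refine ⟨c, cons h R, hR.cons fun hu => hP.2 (hsub hu), hc, ?_, ?_⟩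
      · rw [support_cons, support_cons]
        exact List.cons_subset_cons u hsub
      · intro w hw hwS
        rw [support_cons, List.mem_cons] at hw ⊢
        exact hw.imp_right fun hw => hall w hw hwS
    · have hu : ∀ w ∈ (cons h P).support, w ∈ S → w = u := by
        intro w hw hwS
        rw [support_cons, List.mem_cons] at hw
        exact hw.resolve_right fun hw => hex ⟨w, hw, hwS⟩
      obtain ⟨w, hw, hwS⟩ := hS
      refine ⟨u, .nil, .nil, hu w hw hwS ▸ hwS, by simp, fun w hw hwS => ?_⟩
      simpa using hu w hw hwS

/-- A path with a vertex in `S` has a segment with both ends in `S` that contains all its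
vertices in `S`. -/
theorem IsPath.exists_segment_mem {S : Set V} {u v : V} {P : G.Walk u v} (hP : P.IsPath)
    (hS : ∃ w ∈ P.support, w ∈ S) :
    ∃ (a c : V) (R : G.Walk a c), R.IsPath ∧ a ∈ S ∧ c ∈ S ∧ R.support ⊆ P.support ∧
      ∀ w ∈ P.support, w ∈ S → w ∈ R.support := by
  obtain ⟨c, R, hR, hc, hsub, hall⟩ := hP.exists_prefix_last_mem hS
  obtain ⟨a, Q, hQ, ha, hsub', hall'⟩ :=
    hR.reverse.exists_prefix_last_mem (S := S) ⟨c, by simp, hc⟩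
  simp only [support_reverse, List.mem_reverse] at hall'
  refine ⟨c, a, Q, hQ, hc, ha, fun w hw => hsub ?_, fun w hw hwS => hall' w (hall w hw hwS) hwS⟩
  simpa using hsub' hw

/-- In an acyclic graph, a path between two vertices of a walk stays in that walk. -/
theorem IsPath.support_subset_of_isAcyclic (hG : G.IsAcyclic) {a c u v : V} {R : G.Walk a c}
    (hR : R.IsPath) (Q : G.Walk u v) (ha : a ∈ Q.support) (hc : c ∈ Q.support) :
    R.support ⊆ Q.support := by
  classical
  let T := (Q.takeUntil a ha).reverse.append (Q.takeUntil c hc)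
  have hRT : R = T.bypass :=
    congrArg Subtype.val
      ((hG.subsingleton_path a c).elim ⟨R, hR⟩ ⟨T.bypass, T.bypass_isPath⟩)
  intro w hw
  rw [hRT] at hw
  have hwT : w ∈ T.support := T.support_bypass_subset_support hw
  rw [mem_support_append_iff, support_reverse, List.mem_reverse] at hwT
  exact hwT.elim (fun h => Q.support_takeUntil_subset_support ha h)
    fun h => Q.support_takeUntil_subset_support hc h

theorem IsPath.intersectInPath (hG : G.IsAcyclic) {u₁ v₁ u₂ v₂ x : V} {P : G.Walk u₁ v₁}
    (hP : P.IsPath) (Q : G.Walk u₂ v₂) (hxP : x ∈ P.support) (hxQ : x ∈ Q.support) :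
    IntersectInPath P Q := by
  obtain ⟨a, c, R, hR, ha, hc, hsub, hall⟩ :=
    hP.exists_segment_mem (S := {w | w ∈ Q.support}) ⟨x, hxP, hxQ⟩
  exact ⟨a, c, R, hR, fun w =>
    ⟨fun hw => ⟨hsub hw, hR.support_subset_of_isAcyclic hG Q ha hc hw⟩, fun hw => hall w hw.1 hw.2⟩⟩

/-- A walk descending from above level `s` to level at most `s` splits at its first vertex of
label `s`. -/
theorem exists_eq_append_first_label {γ : V → ℤ} (hγ : ∀ u v : V, G.Adj u v → |γ u - γ v| ≤ 1)
    {s : ℤ} {u v : V} (P : G.Walk u v) (hu : s < γ u) (hv : γ v ≤ s) :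
    ∃ (x : V) (Q : G.Walk u x) (R : G.Walk x v), P = Q.append R ∧ γ x = s ∧
      ∀ w ∈ Q.support, w = x ∨ s < γ w := by
  induction P with
  | nil => omega
  | @cons u x v h P ih =>
    have hux := abs_le.1 (hγ u x h)
    by_cases hx : γ x = s
    · refine ⟨x, cons h nil, P, by simp, hx, ?_⟩
      simp only [support_cons, support_nil, List.mem_cons, List.not_mem_nil, or_false]
      rintro w (rfl | rfl)
      · exact Or.inr hu
      · exact Or.inl rfl
    · obtain ⟨y, Q, R, rfl, hy, hQ⟩ := ih (by omega) hv
      refine ⟨y, cons h Q, R, by simp, hy, ?_⟩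
      simp only [support_cons, List.mem_cons]
      rintro w (rfl | hw)
      · exact Or.inr hu
      · exact hQ w hw

end SimpleGraph.Walk

section

open SimpleGraph Walk

variable {V : Type*} {G : SimpleGraph V} {γ : V → ℤ}

theorem isCap_neg_iff {b : ℤ} {u v : V} {P : G.Walk u v} :
    IsCap (fun w => -γ w) (-b) P ↔ IsCup γ b P := by
  simp [IsCap, IsCup]

theorem IsCap.lt_of_mem {s : ℤ} {u v w : V} {P : G.Walk u v} (hP : IsCap γ s P)
    (hw : w ∈ P.support) (hu : w ≠ u) (hv : w ≠ v) : s < γ w :=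
  lt_of_le_of_ne (hP.2.2.2.1 w hw) (hP.2.2.2.2 w hw hu hv).symm

theorem IsCup.lt_of_mem {b : ℤ} {u v w : V} {P : G.Walk u v} (hP : IsCup γ b P)
    (hw : w ∈ P.support) (hu : w ≠ u) (hv : w ≠ v) : γ w < b :=
  lt_of_le_of_ne (hP.2.2.2.1 w hw) (hP.2.2.2.2 w hw hu hv)

/-- A cap contains a cap of any higher level below the label of one of its vertices. -/
theorem IsCap.exists_subcap (hγ : ∀ u v : V, G.Adj u v → |γ u - γ v| ≤ 1) {s s' : ℤ}
    {u v x : V} {P : G.Walk u v} (hP : IsCap γ s P) (hx : x ∈ P.support) (hs : s ≤ s')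
    (hsx : s' < γ x) :
    ∃ (u' v' : V) (P' : G.Walk u' v'), IsCap γ s' P' ∧ P'.support ⊆ P.support ∧
      x ∈ P'.support := by
  obtain ⟨A, B, rfl⟩ := mem_support_iff_exists_append.1 hx
  obtain ⟨hpath, hu, hv, -, -⟩ := hP
  obtain ⟨y, Q₁, R₁, h₁, hy, hQ₁⟩ :=
    exists_eq_append_first_label hγ A.reverse hsx (hu.trans_le hs)
  obtain ⟨z, Q₂, R₂, rfl, hz, hQ₂⟩ := exists_eq_append_first_label hγ B hsx (hv.trans_le hs)
  have hA : A = R₁.reverse.append Q₁.reverse := by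
    rw [← reverse_append, ← h₁, reverse_reverse]
  subst hA
  have hpath' : (Q₁.reverse.append Q₂).IsPath := by
    rw [← append_assoc, append_assoc Q₁.reverse] at hpath
    exact hpath.of_append_right.of_append_left
  have hmem : ∀ w ∈ (Q₁.reverse.append Q₂).support, w = y ∨ w = z ∨ s' < γ w := by
    intro w hw
    rw [mem_support_append_iff, support_reverse, List.mem_reverse] at hw
    rcases hw with hw | hw
    · exact (hQ₁ w hw).imp_right Or.inr
    · exact Or.inr (hQ₂ w hw)
  refine ⟨y, z, Q₁.reverse.append Q₂, ⟨hpath', hy, hz, fun w hw => ?_, fun w hw hwy hwz => ?_⟩,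
    fun w hw => ?_, by simp⟩
  · rcases hmem w hw with rfl | rfl | h
    · exact hy.ge
    · exact hz.ge
    · exact h.le
  · exact (((hmem w hw).resolve_left hwy).resolve_left hwz).ne'
  · simp only [mem_support_append_iff, support_reverse, List.mem_reverse] at hw ⊢
    tauto

/-- A cup contains a cup of any lower level above the label of one of its vertices. -/
theorem IsCup.exists_subcup (hγ : ∀ u v : V, G.Adj u v → |γ u - γ v| ≤ 1) {b b' : ℤ}
    {u v x : V} {P : G.Walk u v} (hP : IsCup γ b P) (hx : x ∈ P.support) (hb : b' ≤ b)
    (hbx : γ x < b') :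
    ∃ (u' v' : V) (P' : G.Walk u' v'), IsCup γ b' P' ∧ P'.support ⊆ P.support ∧
      x ∈ P'.support := by
  have hγ' : ∀ u v : V, G.Adj u v → |-γ u - -γ v| ≤ 1 := fun u v h => by
    rw [neg_sub_neg]
    exact hγ v u h.symm
  obtain ⟨u', v', P', hP', h⟩ :=
    (isCap_neg_iff.2 hP).exists_subcap hγ' hx (neg_le_neg hb) (neg_lt_neg hbx)
  exact ⟨u', v', P', isCap_neg_iff.1 hP', h⟩

theorem realizesPair_of_isCap_isCup (hG : G.IsAcyclic) {s b : ℤ} {x u₁ v₁ u₂ v₂ : V}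
    {P : G.Walk u₁ v₁} {Q : G.Walk u₂ v₂} (hP : IsCap γ s P) (hQ : IsCup γ b Q)
    (hxP : x ∈ P.support) (hxQ : x ∈ Q.support) (hPb : ∀ w ∈ P.support, γ w < b)
    (hQs : ∀ w ∈ Q.support, s < γ w) : RealizesPair G γ x s b := by
  have hs := hQs x hxQ
  have hb := hPb x hxP
  refine ⟨u₁, v₁, u₂, v₂, P, Q, ⟨hP, hQ, ?_, ?_, ?_, hP.1.intersectInPath hG Q hxP hxQ⟩,
    hxP, ?_, ?_, hxQ, ?_, ?_⟩
  · exact (minLab_le γ P P.start_mem_support).trans_lt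
      ((lt_minLab_iff γ Q _).2 (hP.2.1.symm ▸ hQs))
  · exact (minLab_le γ Q hxQ).trans (le_maxLab γ P hxP)
  · exact ((maxLab_lt_iff γ P _).2 (hQ.2.1.symm ▸ hPb)).trans_le
      (le_maxLab γ Q Q.start_mem_support)
  · rintro rfl; exact hs.ne' hP.2.1
  · rintro rfl; exact hs.ne' hP.2.2.1
  · rintro rfl; exact hb.ne hQ.2.1
  · rintro rfl; exact hb.ne hQ.2.2.1

theorem InterleavingPair.lt_of_mem_cap {s b : ℤ} {u₁ v₁ u₂ v₂ w : V} {P : G.Walk u₁ v₁}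
    {Q : G.Walk u₂ v₂} (h : InterleavingPair γ s b P Q) (hw : w ∈ P.support) : γ w < b := by
  obtain ⟨-, hQ, -, -, hlt, -⟩ := h
  refine (le_maxLab γ P hw).trans_lt (hlt.trans_le ?_)
  by_contra! hb
  exact lt_irrefl _ ((maxLab_lt_iff γ Q _).2 fun w hw => (hQ.2.2.2.1 w hw).trans_lt hb)

theorem InterleavingPair.lt_of_mem_cup {s b : ℤ} {u₁ v₁ u₂ v₂ w : V} {P : G.Walk u₁ v₁}
    {Q : G.Walk u₂ v₂} (h : InterleavingPair γ s b P Q) (hw : w ∈ Q.support) : s < γ w := by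
  obtain ⟨hP, -, hlt, -, -, -⟩ := h
  refine lt_of_le_of_lt ?_ (hlt.trans_le (minLab_le γ Q hw))
  by_contra! hs
  exact lt_irrefl _ ((lt_minLab_iff γ P _).2 fun w hw => hs.trans_le (hP.2.2.2.1 w hw))

end

/-- Let `G` be a subdivided star with center `v₀` (a tree all
of whose vertices other than `v₀` have degree at most `2`), equipped with an
integer labeling `γ` whose values differ by at most `1` on adjacent vertices.
If `s < s' < b < b'` and both `(s, b)` and `(s', b')` belong to the set `I` of
pairs realized by interleaving cap/cup pairs through `v₀`, then `(s, b')` and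
`(s', b)` belong to `I` as well. -/
theorem realizesPair_exchange {V : Type*} [Fintype V] (G : SimpleGraph V)
    [DecidableRel G.Adj] (v₀ : V) (hTree : G.IsTree)
    (hdeg : ∀ w : V, w ≠ v₀ → G.degree w ≤ 2)
    (γ : V → ℤ) (hγ : ∀ u v : V, G.Adj u v → |γ u - γ v| ≤ 1)
    (s s' b b' : ℤ) (hss' : s < s') (hs'b : s' < b) (hbb' : b < b')
    (hsb : RealizesPair G γ v₀ s b) (hs'b' : RealizesPair G γ v₀ s' b') :
    RealizesPair G γ v₀ s b' ∧ RealizesPair G γ v₀ s' b := by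
  obtain ⟨u₁, w₁, u₂, w₂, P₁, P₂, h, hv₁, -, -, -, -, -⟩ := hsb
  obtain ⟨u₁', w₁', u₂', w₂', Q₁, Q₂, h', -, -, -, hv₂, -, -⟩ := hs'b'
  have hG : G.IsAcyclic := hTree.isAcyclic
  refine ⟨realizesPair_of_isCap_isCup hG h.1 h'.2.1 hv₁ hv₂
    (fun w hw => (h.lt_of_mem_cap hw).trans hbb') fun w hw => hss'.trans (h'.lt_of_mem_cup hw), ?_⟩
  obtain ⟨_, _, P, hP, hPsub, hvP⟩ := h.1.exists_subcap hγ hv₁ hss'.le (h'.lt_of_mem_cup hv₂)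
  obtain ⟨_, _, Q, hQ, hQsub, hvQ⟩ := h'.2.1.exists_subcup hγ hv₂ hbb'.le (h.lt_of_mem_cap hv₁)
  exact realizesPair_of_isCap_isCup hG hP hQ hvP hvQ (fun w hw => h.lt_of_mem_cap (hPsub hw))
    fun w hw => h'.lt_of_mem_cup (hQsub hw)
end

section
/- Let k ≥ 1 and let l₀ < l₁ < … < l_{k−1} be positive integers and l₀', …, l_{k−1}' positive integers. Set l = Σ_{i=0}^{k−1} l_i. Then Σ_{i=0}^{k−1} (Σ_{j=i}^{k−1} l_j') · l_i² ≤ l · Σ_{i=0}^{k−1} l_i · l_i' ≤ (Σ_{i=0}^{k−1} l_i · l_i')². -/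
open Finset

/-- Let `k ≥ 1`, let `L 0 < L 1 < … < L (k-1)` be positive
integers and `L' 0, …, L' (k-1)` positive integers, and set `l = Σ_i L i`.
Then
`Σ_{i<k} (Σ_{j=i}^{k-1} L' j) · (L i)² ≤ l · Σ_{i<k} L i · L' i ≤ (Σ_{i<k} L i · L' i)²`. -/
theorem star_running_time_bound (k : ℕ) (hk : 1 ≤ k) (L L' : ℕ → ℕ)
    (hLpos : ∀ i < k, 0 < L i) (hL'pos : ∀ i < k, 0 < L' i)
    (hmono : ∀ i j, i < j → j < k → L i < L j) :
    (∑ i ∈ range k, (∑ j ∈ Ico i k, L' j) * (L i) ^ 2) ≤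
        (∑ i ∈ range k, L i) * (∑ i ∈ range k, L i * L' i) ∧
      (∑ i ∈ range k, L i) * (∑ i ∈ range k, L i * L' i) ≤
        (∑ i ∈ range k, L i * L' i) ^ 2 := by
  constructor
  · rw [sum_mul]
    refine sum_le_sum fun i hi => ?_
    calc (∑ j ∈ Ico i k, L' j) * L i ^ 2 = L i * ∑ j ∈ Ico i k, L i * L' j := by
          rw [← mul_sum]; ring
      _ ≤ L i * ∑ j ∈ Ico i k, L j * L' j := by
          gcongr with j hj
          obtain ⟨hij, hjk⟩ := mem_Ico.mp hj
          rcases hij.eq_or_lt with rfl | hlt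
          · exact le_rfl
          · exact (hmono i j hlt hjk).le
      _ ≤ L i * ∑ j ∈ range k, L j * L' j := by
          gcongr
          exact fun j hj => mem_range.mpr (mem_Ico.mp hj).2
  · rw [sq]
    gcongr with i hi
    exact Nat.le_mul_of_pos_right _ (hL'pos i (mem_range.mp hi))
end

section
/- Let m be an integer and I a finite nonempty set of pairs (s, b) of integers with s < m < b for every (s, b) ∈ I, closed under exchange: whenever (s, b), (s', b') ∈ I with s < s' and b < b', also (s, b'), (s', b) ∈ I. Define a chain (s₀, b₀), (s₁, b₁), … of members of I recursively: (s₀, b₀) is the member whose first coordinate is maximal and whose second coordinate is minimal (it exists by the exchange property), and as long as some member of I has first coordinate strictly less than s_k and second coordinate strictly greater than b_k, let (s_{k+1}, b_{k+1}) be the member among those whose first coordinate is maximal and whose second coordinate is minimal (again it exists by the exchange property). Then every pair (s, b) ∈ I satisfies s = s_k or b = b_k for some index k of the chain. -/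
/-- Let `m` be an integer and `I` a finite nonempty set of
pairs `(s, b)` of integers with `s < m < b` for every `(s, b) ∈ I`, closed
under exchange: whenever `(s, b), (s', b') ∈ I` with `s < s'` and `b < b'`,
also `(s, b'), (s', b) ∈ I`.  Let `(c 0, …, c N)` be the chain in `I` defined
recursively: `c 0` is the member of `I` whose first coordinate is maximal and
whose second coordinate is minimal; as long as some member of `I` has first
coordinate strictly less than `(c k).1` and second coordinate strictly greater
than `(c k).2`, the next member `c (k+1)` is the one among those whose first
coordinate is maximal and whose second coordinate is minimal; the chain stops
at `c N` when no such member remains.  Then every pair `(s, b) ∈ I` satisfies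
`s = (c k).1` or `b = (c k).2` for some index `k ≤ N` of the chain. -/
theorem staircase_chain_covers (m : ℤ) (I : Finset (ℤ × ℤ)) (hne : I.Nonempty)
    (hm : ∀ p ∈ I, p.1 < m ∧ m < p.2)
    (hex : ∀ p ∈ I, ∀ q ∈ I, p.1 < q.1 → p.2 < q.2 →
      (p.1, q.2) ∈ I ∧ (q.1, p.2) ∈ I)
    (N : ℕ) (c : ℕ → ℤ × ℤ)
    (hc0 : c 0 ∈ I ∧ (∀ q ∈ I, q.1 ≤ (c 0).1) ∧ (∀ q ∈ I, (c 0).2 ≤ q.2))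
    (hstep : ∀ k < N, c (k + 1) ∈ I ∧
      (c (k + 1)).1 < (c k).1 ∧ (c k).2 < (c (k + 1)).2 ∧
      ∀ q ∈ I, q.1 < (c k).1 → (c k).2 < q.2 →
        q.1 ≤ (c (k + 1)).1 ∧ (c (k + 1)).2 ≤ q.2)
    (hterm : ¬ ∃ q ∈ I, q.1 < (c N).1 ∧ (c N).2 < q.2) :
    ∀ p ∈ I, ∃ k ≤ N, p.1 = (c k).1 ∨ p.2 = (c k).2 := by
  intro p hp
  by_contra! h
  have key : ∀ k ≤ N, p.1 < (c k).1 ∧ (c k).2 < p.2 := by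
    intro k
    induction k with
    | zero =>
      intro hk
      obtain ⟨h1, h2⟩ := h 0 hk
      exact ⟨lt_of_le_of_ne (hc0.2.1 p hp) h1, lt_of_le_of_ne (hc0.2.2 p hp) h2.symm⟩
    | succ k ih =>
      intro hk
      obtain ⟨h1, h2⟩ := h (k + 1) hk
      obtain ⟨hs, hb⟩ := ih (Nat.le_of_succ_le hk)
      obtain ⟨hs', hb'⟩ := (hstep k hk).2.2.2 p hp hs hb
      exact ⟨lt_of_le_of_ne hs' h1, lt_of_le_of_ne hb' h2.symm⟩
  exact hterm ⟨p, hp, key N le_rfl⟩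
end
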